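/- Decomposition of cylinders by Cartier-Foata prefixes: for a nonempty trace u with Cartier-Foata decomposition c₁ → … → c_n and v = c₁·…·c_{n-1}, one has (i) ↑u = {ξ ∈ BM : C₁(ξ)·…·C_n(ξ) ≥ u}, and (ii) {ξ : C₁(ξ)=c₁, …, C_n(ξ)=c_n} = ↑u \ ∪_{c clique, c > c_n} ↑(v·c). -/

import Mathlib

open scoped Classical

variable {α : Type*}

/-- A clique of the independence graph. -/
def IsCliq (I : α → α → Prop) (c : Finset α) : Prop :=
  ∀ a ∈ c, ∀ b ∈ c, a ≠ b → I a b

/-- Cartier–Foata admissibility `c → c'`. -/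
def CFadm (I : α → α → Prop) (c c' : Finset α) : Prop :=
  ∀ b ∈ c', ∃ a ∈ c, ¬ I a b

/-- Parallelism of cliques: `c ∥ c'`. -/
def Par (I : α → α → Prop) (c c' : Finset α) : Prop :=
  ∀ a ∈ c, ∀ b ∈ c', I a b

/-- The commutation relation generating the trace monoid congruence. -/
def traceRel (I : α → α → Prop) : FreeMonoid α → FreeMonoid α → Prop :=
  fun x y => ∃ a b, I a b ∧ x = FreeMonoid.of a * FreeMonoid.of b ∧
    y = FreeMonoid.of b * FreeMonoid.of a

/-- The trace monoid `M(Σ, I)`. -/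
abbrev TM (I : α → α → Prop) := Con.Quotient (conGen (traceRel I))

/-- Canonical projection from the free monoid. -/
def mkTM (I : α → α → Prop) : FreeMonoid α →* TM I := Con.mk' _

/-- The image of a letter in the trace monoid. -/
def emb (I : α → α → Prop) (a : α) : TM I := mkTM I (FreeMonoid.of a)

/-- The trace associated to a clique. -/
noncomputable def ctr (I : α → α → Prop) (c : Finset α) : TM I :=
  mkTM I ((c.toList.map FreeMonoid.of).prod)

/-- The prefix (left divisibility) order on traces. -/
def pref (I : α → α → Prop) (u v : TM I) : Prop := ∃ w, v = u * w

theorem pref_trans (I : α → α → Prop) {u v w : TM I} (h1 : pref I u v)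
    (h2 : pref I v w) : pref I u w := by
  obtain ⟨a, rfl⟩ := h1; obtain ⟨b, rfl⟩ := h2; exact ⟨a * b, mul_assoc _ _ _⟩

/-- Nondecreasing sequences of traces. -/
def HSeq (I : α → α → Prop) := {x : ℕ → TM I // ∀ n, pref I (x n) (x (n + 1))}

/-- The domination preorder on nondecreasing sequences. -/
def preceq (I : α → α → Prop) (x y : HSeq I) : Prop := ∀ n, ∃ m, pref I (x.1 n) (y.1 m)

instance hseqSetoid (I : α → α → Prop) : Setoid (HSeq I) where
  r x y := preceq I x y ∧ preceq I y x
  iseqv := by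
    constructor
    · intro x; constructor <;> exact fun n => ⟨n, 1, (mul_one _).symm⟩
    · rintro x y ⟨h1, h2⟩; exact ⟨h2, h1⟩
    · rintro x y z ⟨h1, h2⟩ ⟨h3, h4⟩
      constructor
      · intro n; obtain ⟨m, hm⟩ := h1 n; obtain ⟨k, hk⟩ := h3 m
        exact ⟨k, pref_trans I hm hk⟩
      · intro n; obtain ⟨m, hm⟩ := h4 n; obtain ⟨k, hk⟩ := h2 m
        exact ⟨k, pref_trans I hm hk⟩

/-- Generalized traces: the collapse of the preordered set of nondecreasing sequences. -/
def GT (I : α → α → Prop) := Quotient (hseqSetoid I)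

/-- A finite trace, seen as a generalized trace. -/
def toGT (I : α → α → Prop) (u : TM I) : GT I :=
  Quotient.mk (hseqSetoid I) ⟨fun _ => u, fun _ => ⟨1, (mul_one u).symm⟩⟩

/-- `u` is a prefix of the generalized trace `ξ`. -/
def leT (I : α → α → Prop) (u : TM I) (ξ : GT I) : Prop :=
  Quotient.liftOn ξ (fun x => ∃ m, pref I u (x.1 m)) (by
    rintro x y ⟨hxy, hyx⟩
    apply propext
    constructor
    · rintro ⟨m, hm⟩; obtain ⟨k, hk⟩ := hxy m; exact ⟨k, pref_trans I hm hk⟩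
    · rintro ⟨m, hm⟩; obtain ⟨k, hk⟩ := hyx m; exact ⟨k, pref_trans I hm hk⟩)

/-- The boundary at infinity: generalized traces that are not finite traces. -/
def Bdry (I : α → α → Prop) := {ξ : GT I // ∀ u : TM I, ξ ≠ toGT I u}

/-- The elementary cylinder of base `u`. -/
def cylSet (I : α → α → Prop) (u : TM I) : Set (Bdry I) := {ξ | leT I u ξ.1}

/-- The σ-algebra generated by elementary cylinders. -/
instance bdryMeasurableSpace (I : α → α → Prop) : MeasurableSpace (Bdry I) :=
  MeasurableSpace.generateFrom {s | ∃ u : TM I, s = cylSet I u}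

section Letters

variable (I : α → α → Prop)

theorem emb_commute {a b : α} (h : I a b) : Commute (emb I a) (emb I b) := by
  have : conGen (traceRel I) (FreeMonoid.of a * FreeMonoid.of b)
      (FreeMonoid.of b * FreeMonoid.of a) := ConGen.Rel.of _ _ ⟨a, b, h, rfl, rfl⟩
  exact (Con.eq _).2 this

theorem ctr_eq_prod (c : Finset α) : ctr I c = (c.toList.map (emb I)).prod := by
  simp only [ctr, map_list_prod, List.map_map]
  rfl

theorem tm_induction {p : TM I → Prop} (one : p 1)
    (cons : ∀ a t, p t → p (emb I a * t)) (t : TM I) : p t := by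
  induction t using Con.induction_on with
  | H w =>
    induction w using FreeMonoid.recOn with
    | one => exact one
    | of_mul a w ih => exact cons a _ ih

theorem toList_pairwise {c : Finset α} (hc : IsCliq I c) : c.toList.Pairwise I :=
  (Finset.nodup_toList c).imp_of_mem
    fun ha hb hab => hc _ (Finset.mem_toList.1 ha) _ (Finset.mem_toList.1 hb) hab

theorem IsCliq.insert {I : α → α → Prop} (hsymm : ∀ a b, I a b → I b a) {c : Finset α}
    (hc : IsCliq I c) {b : α} (h : ∀ a ∈ c, I a b) : IsCliq I (insert b c) := by
  intro x hx y hy hxy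
  rcases Finset.mem_insert.1 hx with hx | hx <;> rcases Finset.mem_insert.1 hy with hy | hy
  · exact absurd (hx.trans hy.symm) hxy
  · exact hx ▸ hsymm _ _ (h _ hy)
  · exact hy ▸ h _ hx
  · exact hc _ hx _ hy hxy

theorem ctr_insert (hsymm : ∀ a b, I a b → I b a) {c : Finset α} (hc : IsCliq I c) {b : α}
    (hb : b ∉ c) (h : ∀ a ∈ c, I a b) : ctr I (insert b c) = ctr I c * emb I b := by
  have hp : (insert b c).toList.Perm (b :: c.toList) := Finset.toList_insert hb
  have hcomm : ((insert b c).toList.map (emb I)).Pairwise Commute :=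
    List.pairwise_map.2 ((toList_pairwise I (hc.insert hsymm h)).imp fun h => emb_commute I h)
  rw [ctr_eq_prod, ctr_eq_prod, (hp.map (emb I)).prod_eq' hcomm, List.map_cons, List.prod_cons]
  refine (Commute.list_prod_right (c.toList.map (emb I)) (emb I b) ?_).eq
  intro x hx
  obtain ⟨a, ha, rfl⟩ := List.mem_map.1 hx
  exact (emb_commute I (h a (Finset.mem_toList.1 ha))).symm

/-- The multiset of letters of a trace. -/
def letters : TM I →* Multiplicative (Multiset α) :=
  Con.lift _ (FreeMonoid.lift fun a => Multiplicative.ofAdd {a}) <| by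
    refine Con.conGen_le.2 ?_
    rintro _ _ ⟨a, b, -, rfl, rfl⟩
    simp [Con.ker_rel, mul_comm]

theorem letters_emb (a : α) : (letters I (emb I a)).toAdd = {a} := by
  change (FreeMonoid.lift (fun a => Multiplicative.ofAdd ({a} : Multiset α))
    (FreeMonoid.of a)).toAdd = {a}
  simp

theorem letters_ctr (c : Finset α) : (letters I (ctr I c)).toAdd = c.val := by
  have h : ∀ L : List α, (letters I (L.map (emb I)).prod).toAdd = (L : Multiset α) := by
    intro L
    induction L with
    | nil => simp
    | cons a L ih => simp [letters_emb, ih]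
  rw [ctr_eq_prod, h, Finset.coe_toList]

/-- The length of a trace. -/
def len (t : TM I) : ℕ := (letters I t).toAdd.card

theorem len_mul (x y : TM I) : len I (x * y) = len I x + len I y := by simp [len]

theorem len_emb (a : α) : len I (emb I a) = 1 := by simp [len, letters_emb]

theorem len_ctr (c : Finset α) : len I (ctr I c) = c.card := by simp [len, letters_ctr]

theorem len_le_of_pref {x y : TM I} (h : pref I x y) : len I x ≤ len I y := by
  obtain ⟨w, rfl⟩ := h
  simp [len_mul]

theorem leT_of_pref {u v : TM I} {ξ : GT I} (h : pref I u v) (hv : leT I v ξ) : leT I u ξ := by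
  induction ξ using Quotient.inductionOn with
  | _ x =>
    obtain ⟨m, hm⟩ := hv
    exact ⟨m, pref_trans I h hm⟩

end Letters

section Truncation

variable (I : α → α → Prop)

/-- Piling the letter `a` on top of a heap: the first component records, for each letter, the
height of the highest piece on which it would rest, the second one the part of the heap lying
strictly below level `n`. -/
noncomputable def pile (n : ℕ) (a : α) (s : (α → ℕ) × TM I) : (α → ℕ) × TM I :=
  (fun b => if I a b then s.1 b else max (s.1 b) (s.1 a + 1),
    if s.1 a < n then s.2 * emb I a else s.2)

theorem pile_comm (n : ℕ) {a b : α} (hab : I a b) (hba : I b a) (s : (α → ℕ) × TM I) :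
    pile I n b (pile I n a s) = pile I n a (pile I n b s) := by
  have h := (emb_commute I hab).eq
  ext1
  · funext x
    simp only [pile, hab, hba, if_true]
    split_ifs <;> simp [max_right_comm]
  · simp only [pile, hab, hba, if_true]
    split_ifs <;> simp [mul_assoc, h]

variable (hsymm : ∀ a b, I a b → I b a)

/-- The right action of the trace monoid on heaps generated by `pile`. -/
noncomputable def pileHom (n : ℕ) : TM I →* (Function.End ((α → ℕ) × TM I))ᵐᵒᵖ :=
  Con.lift _ (FreeMonoid.lift fun a => MulOpposite.op (pile I n a)) <| by
    refine Con.conGen_le.2 ?_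
    rintro _ _ ⟨a, b, hab, rfl, rfl⟩
    rw [Con.ker_rel, map_mul, map_mul, FreeMonoid.lift_eval_of, FreeMonoid.lift_eval_of]
    exact congrArg (MulOpposite.op (α := Function.End ((α → ℕ) × TM I))) (funext fun s => pile_comm I n hab (hsymm _ _ hab) s)

/-- The heap of a trace, truncated at height `n`. -/
noncomputable def heap (n : ℕ) (t : TM I) : (α → ℕ) × TM I :=
  (pileHom I hsymm n t).unop (fun _ => 0, 1)

/-- The part of a trace below height `n`. -/
noncomputable def trunc (n : ℕ) (t : TM I) : TM I := (heap I hsymm n t).2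

theorem heap_one (n : ℕ) : heap I hsymm n 1 = (fun _ => 0, 1) := by
  simp only [heap, map_one]
  rfl

theorem heap_mul_emb (n : ℕ) (t : TM I) (a : α) :
    heap I hsymm n (t * emb I a) = pile I n a (heap I hsymm n t) := by
  simp only [heap, map_mul]
  rfl

theorem heap_mul_prod (n : ℕ) (t : TM I) (L : List α) :
    heap I hsymm n (t * (L.map (emb I)).prod) =
      L.foldl (fun s a => pile I n a s) (heap I hsymm n t) := by
  induction L generalizing t with
  | nil => simp
  | cons a L ih => rw [List.map_cons, List.prod_cons, ← mul_assoc, ih, heap_mul_emb,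
      List.foldl_cons]

theorem trunc_mul_emb (n : ℕ) (t : TM I) (a : α) :
    trunc I hsymm n (t * emb I a) =
      if (heap I hsymm n t).1 a < n then trunc I hsymm n t * emb I a else trunc I hsymm n t := by
  simp only [trunc, heap_mul_emb]
  rfl

theorem trunc_mul (n : ℕ) (x y : TM I) :
    pref I (trunc I hsymm n x) (trunc I hsymm n (x * y)) ∧
      len I (trunc I hsymm n (x * y)) ≤ len I (trunc I hsymm n x) + len I y := by
  induction y using tm_induction generalizing x with
  | one => simpa using ⟨1, (mul_one _).symm⟩
  | cons a y ih =>
    obtain ⟨h₁, h₂⟩ := ih (x * emb I a)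
    rw [trunc_mul_emb] at h₁ h₂
    rw [← mul_assoc, len_mul, len_emb]
    split_ifs at h₁ h₂
    · rw [len_mul, len_emb] at h₂
      exact ⟨pref_trans I ⟨_, rfl⟩ h₁, by omega⟩
    · exact ⟨h₁, by omega⟩

theorem trunc_mono (n : ℕ) {x y : TM I} (h : pref I x y) :
    pref I (trunc I hsymm n x) (trunc I hsymm n y) := by
  obtain ⟨w, rfl⟩ := h
  exact (trunc_mul I hsymm n x w).1

theorem foldl_pile_le (n k : ℕ) (hk : k < n) (L : List α) (hL : L.Pairwise I)
    (s : (α → ℕ) × TM I) (h₁ : ∀ a ∈ L, s.1 a ≤ k) (h₂ : ∀ b, s.1 b ≤ k + 1) :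
    (∀ b, (L.foldl (fun s a => pile I n a s) s).1 b ≤ k + 1) ∧
      (L.foldl (fun s a => pile I n a s) s).2 = s.2 * (L.map (emb I)).prod := by
  induction L generalizing s with
  | nil => simpa using h₂
  | cons a L ih =>
    rw [List.pairwise_cons] at hL
    have ha : s.1 a ≤ k := h₁ a (by simp)
    obtain ⟨h₃, h₄⟩ := ih hL.2 (pile I n a s)
      (fun b hb => by simpa [pile, hL.1 b hb] using h₁ b (by simp [hb]))
      (fun b => by
        have := h₂ b
        simp only [pile]
        split_ifs <;> omega)
    refine ⟨h₃, h₄.trans ?_⟩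
    simp [pile, lt_of_le_of_lt ha hk, mul_assoc]

theorem foldl_pile_eq (n k : ℕ) (L : List α) (hL : L.Pairwise I)
    (s : (α → ℕ) × TM I) (h₁ : ∀ a ∈ L, s.1 a = k) (h₂ : ∀ b, s.1 b ≤ k + 1) :
    (∀ b, (L.foldl (fun s a => pile I n a s) s).1 b ≤ k + 1) ∧
      (∀ b, (s.1 b = k + 1 ∨ ∃ a ∈ L, ¬ I a b) →
        (L.foldl (fun s a => pile I n a s) s).1 b = k + 1) ∧
      (L.foldl (fun s a => pile I n a s) s).2 =
        if k < n then s.2 * (L.map (emb I)).prod else s.2 := by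
  induction L generalizing s with
  | nil => simpa using h₂
  | cons a L ih =>
    rw [List.pairwise_cons] at hL
    have ha : s.1 a = k := h₁ a (by simp)
    obtain ⟨h₃, h₄, h₅⟩ := ih hL.2 (pile I n a s)
      (fun b hb => by simpa [pile, hL.1 b hb] using h₁ b (by simp [hb]))
      (fun b => by
        have := h₂ b
        simp only [pile]
        split_ifs <;> omega)
    refine ⟨h₃, fun b hb => h₄ b ?_, h₅.trans ?_⟩
    · have := h₂ b
      by_cases hab : I a b
      · simpa [pile, hab] using hb
      · left
        simp only [pile, hab, if_false]
        omega
    · simp only [pile, ha, List.map_cons, List.prod_cons]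
      split_ifs <;> simp [mul_assoc]

end Truncation

section CliqueSequences

variable (I : α → α → Prop)

/-- The product of the first `n` cliques of a sequence. -/
noncomputable def cliqProd (D : ℕ → Finset α) (n : ℕ) : TM I :=
  ((List.range n).map fun i => ctr I (D i)).prod

theorem cliqProd_succ (D : ℕ → Finset α) (n : ℕ) :
    cliqProd I D (n + 1) = cliqProd I D n * ctr I (D n) := by
  simp [cliqProd, List.range_succ]

theorem cliqProd_congr {D E : ℕ → Finset α} {n : ℕ} (h : ∀ i < n, D i = E i) :
    cliqProd I D n = cliqProd I E n := by
  unfold cliqProd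
  congr 1
  exact List.map_congr_left fun i hi => by rw [h i (List.mem_range.1 hi)]

theorem cliqProd_mono (D : ℕ → Finset α) {m n : ℕ} (h : m ≤ n) :
    pref I (cliqProd I D m) (cliqProd I D n) := by
  induction n, h using Nat.le_induction with
  | base => exact ⟨1, (mul_one _).symm⟩
  | succ n _ ih => exact pref_trans I ih ⟨_, cliqProd_succ I D n⟩

theorem prod_map_ctr_eq_cliqProd (l : List (Finset α)) :
    (l.map (ctr I)).prod = cliqProd I (fun i => l.getD i ∅) l.length := by
  unfold cliqProd
  congr 1
  refine List.ext_getElem (by simp) fun i h₁ h₂ => ?_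
  have : i < l.length := by simpa using h₁
  simp [this]

variable (hsymm : ∀ a b, I a b → I b a)

theorem heap_cliqProd_of_le (n k : ℕ) (hk : k ≤ n) (D : ℕ → Finset α)
    (hD : ∀ i < k, IsCliq I (D i)) :
    (∀ b, (heap I hsymm n (cliqProd I D k)).1 b ≤ k) ∧
      trunc I hsymm n (cliqProd I D k) = cliqProd I D k := by
  induction k with
  | zero => simp [cliqProd, heap_one, trunc]
  | succ k ih =>
    obtain ⟨h₁, h₂⟩ := ih (by omega) fun i hi => hD i (by omega)
    have := foldl_pile_le I n k hk _ (toList_pairwise I (hD k (by omega)))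
      (heap I hsymm n (cliqProd I D k)) (fun a _ => h₁ a) (fun b => (h₁ b).trans (by omega))
    rw [← heap_mul_prod, ← ctr_eq_prod, ← cliqProd_succ] at this
    refine ⟨this.1, this.2.trans ?_⟩
    rw [cliqProd_succ]
    exact congrArg (· * _) h₂

theorem heap_cliqProd (n k : ℕ) (D : ℕ → Finset α) (hD : ∀ i < k, IsCliq I (D i))
    (hadm : ∀ i, i + 1 < k → CFadm I (D i) (D (i + 1))) :
    (∀ b, (heap I hsymm n (cliqProd I D k)).1 b ≤ k) ∧
      (∀ i, k = i + 1 → ∀ b, (∃ a ∈ D i, ¬ I a b) →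
        (heap I hsymm n (cliqProd I D k)).1 b = k) ∧
      trunc I hsymm n (cliqProd I D k) = cliqProd I D (min n k) := by
  induction k with
  | zero => simp [cliqProd, heap_one, trunc]
  | succ k ih =>
    obtain ⟨h₁, h₂, h₃⟩ := ih (fun i hi => hD i (by omega)) fun i hi => hadm i (by omega)
    have hlow : ∀ a ∈ (D k).toList, (heap I hsymm n (cliqProd I D k)).1 a = k := by
      intro a ha
      rw [Finset.mem_toList] at ha
      cases k with
      | zero => exact Nat.le_zero.1 (h₁ a)
      | succ j => exact h₂ j rfl a (hadm j (by omega) a ha)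
    have := foldl_pile_eq I n k _ (toList_pairwise I (hD k (by omega)))
      (heap I hsymm n (cliqProd I D k)) hlow (fun b => (h₁ b).trans (by omega))
    rw [← heap_mul_prod, ← ctr_eq_prod, ← cliqProd_succ] at this
    refine ⟨this.1, ?_, this.2.2.trans ?_⟩
    · rintro i hi b ⟨a, ha, hab⟩
      obtain rfl : k = i := by omega
      exact this.2.1 b (Or.inr ⟨a, Finset.mem_toList.2 ha, hab⟩)
    · change (if k < n then trunc I hsymm n _ * _ else trunc I hsymm n _) = _
      rw [h₃]
      split_ifs with hkn
      · rw [min_eq_right hkn.le, min_eq_right hkn, cliqProd_succ]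
      · rw [min_eq_left (by omega), min_eq_left (by omega)]

theorem cliqProd_pref_of_pref (hsymm : ∀ a b, I a b → I b a) {n N : ℕ} {D E : ℕ → Finset α} (hD : ∀ i < n, IsCliq I (D i))
    (hE : ∀ i, IsCliq I (E i)) (hadm : ∀ i, CFadm I (E i) (E (i + 1)))
    (h : pref I (cliqProd I D n) (cliqProd I E N)) :
    pref I (cliqProd I D n) (cliqProd I E n) := by
  have := trunc_mono I hsymm n h
  rw [(heap_cliqProd_of_le I hsymm n n le_rfl D hD).2,
    (heap_cliqProd I hsymm n N E (fun i _ => hE i) fun i _ => hadm i).2.2] at this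
  exact pref_trans I this (cliqProd_mono I E (min_le_left _ _))

theorem cliqProd_injective (hsymm : ∀ a b, I a b → I b a) {n : ℕ} {D E : ℕ → Finset α} (hD : ∀ i < n, IsCliq I (D i))
    (hDadm : ∀ i, i + 1 < n → CFadm I (D i) (D (i + 1))) (hE : ∀ i < n, IsCliq I (E i))
    (hEadm : ∀ i, i + 1 < n → CFadm I (E i) (E (i + 1)))
    (h : cliqProd I D n = cliqProd I E n) (i : ℕ) (hi : i < n) : D i = E i := by
  have key : ∀ k ≤ n, cliqProd I D k = cliqProd I E k := by
    intro k hk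
    have := congrArg (trunc I hsymm k) h
    rwa [(heap_cliqProd I hsymm k n D hD hDadm).2.2, (heap_cliqProd I hsymm k n E hE hEadm).2.2,
      min_eq_left hk] at this
  have h₁ := key (i + 1) hi
  rw [cliqProd_succ, cliqProd_succ, key i hi.le] at h₁
  have h₂ := congrArg (fun t => (letters I t).toAdd) h₁
  simp only [map_mul, toAdd_mul, letters_ctr, add_right_inj] at h₂
  exact Finset.val_injective h₂

/-- A Cartier–Foata product of `m + 1` cliques that is a strict prefix of another product of
`m + 1` cliques can be extended in its last clique. -/
theorem exists_insert_pref (hsymm : ∀ a b, I a b → I b a) (hirr : ∀ a, ¬ I a a) {m : ℕ}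
    {D E : ℕ → Finset α} (hD : ∀ i < m + 1, IsCliq I (D i))
    (hadm : ∀ i, i + 1 < m + 1 → CFadm I (D i) (D (i + 1)))
    (hE : ∀ i < m + 1, IsCliq I (E i))
    (h : pref I (cliqProd I D (m + 1)) (cliqProd I E (m + 1)))
    (hne : cliqProd I E (m + 1) ≠ cliqProd I D (m + 1)) :
    ∃ c, IsCliq I c ∧ D m ⊂ c ∧ pref I (cliqProd I D m * ctr I c) (cliqProd I E (m + 1)) := by
  obtain ⟨w, hw⟩ := h
  obtain rfl | ⟨b, w, rfl⟩ : w = 1 ∨ ∃ b w', w = emb I b * w' :=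
    tm_induction I (p := fun w => w = 1 ∨ ∃ b w', w = emb I b * w') (Or.inl rfl)
      (fun b w' _ => Or.inr ⟨b, w', rfl⟩) w
  · exact absurd (hw.trans (mul_one _)) hne
  by_cases hpar : ∀ a ∈ D m, I a b
  · have hb : b ∉ D m := fun hb => hirr b (hpar b hb)
    have hDm := hD m (by omega)
    refine ⟨insert b (D m), hDm.insert hsymm hpar, Finset.ssubset_insert hb, w, ?_⟩
    rw [ctr_insert I hsymm hDm hb hpar, hw, cliqProd_succ]
    simp only [mul_assoc]
  · push Not at hpar
    exfalso
    obtain ⟨-, h₁, h₂⟩ := heap_cliqProd I hsymm (m + 1) (m + 1) D hD hadm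
    have h₃ := trunc_mul_emb I hsymm (m + 1) (cliqProd I D (m + 1)) b
    rw [if_neg (by rw [h₁ m rfl b hpar]; omega), h₂, min_self] at h₃
    have h₄ := (trunc_mul I hsymm (m + 1) (cliqProd I D (m + 1) * emb I b) w).2
    rw [h₃, mul_assoc, ← hw, (heap_cliqProd_of_le I hsymm (m + 1) (m + 1) le_rfl E hE).2, hw,
      len_mul, len_mul, len_emb] at h₄
    omega

end CliqueSequences

/-- Decomposition of cylinders by Cartier–Foata prefixes. Here `C ξ` is the
(unique) Cartier–Foata decomposition of the infinite trace `ξ` into nonempty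
cliques, with `ξ = sup_n C₁⋯C_n`. For a nonempty trace `u` with Cartier–Foata
decomposition `l = [c₁, …, c_n]` and `v = c₁⋯c_{n-1}`:
(i) `↑u = {ξ : C₁(ξ)⋯C_n(ξ) ≥ u}`, and
(ii) `{ξ : C₁(ξ)=c₁, …, C_n(ξ)=c_n} = ↑u \ ⋃_{c ⊋ c_n clique} ↑(v·c)`. -/
theorem cylinder_CF_decomposition {α : Type*} [Fintype α] (I : α → α → Prop)
    (hsymm : ∀ a b, I a b → I b a) (hirr : ∀ a, ¬ I a a)
    (C : Bdry I → ℕ → Finset α)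
    (hCF : ∀ ξ : Bdry I,
      (∀ i, (C ξ i).Nonempty ∧ IsCliq I (C ξ i)) ∧
      (∀ i, CFadm I (C ξ i) (C ξ (i + 1))) ∧
      (∀ n, leT I (((List.range n).map (fun i => ctr I (C ξ i))).prod) ξ.1) ∧
      (∀ u : TM I, leT I u ξ.1 →
        ∃ n, pref I u (((List.range n).map (fun i => ctr I (C ξ i))).prod)))
    (u : TM I) (l : List (Finset α)) (hne : l ≠ [])
    (hl : ∀ c ∈ l, (c : Finset α).Nonempty ∧ IsCliq I c)
    (hch : l.Chain' (CFadm I))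
    (hprod : (l.map (ctr I)).prod = u) :
    cylSet I u =
      {ξ : Bdry I |
        pref I u (((List.range l.length).map (fun i => ctr I (C ξ i))).prod)} ∧
    {ξ : Bdry I | ∀ i < l.length, C ξ i = l.getD i ∅} =
      cylSet I u \
        ⋃ c ∈ {c : Finset α | IsCliq I c ∧ l.getLast hne ⊂ c},
          cylSet I ((l.dropLast.map (ctr I)).prod * ctr I c) := by
  have hE : ∀ ξ i, IsCliq I (C ξ i) := fun ξ i => ((hCF ξ).1 i).2
  have hEadm : ∀ ξ i, CFadm I (C ξ i) (C ξ (i + 1)) := fun ξ => (hCF ξ).2.1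
  have hpre : ∀ ξ n, leT I (cliqProd I (C ξ) n) ξ.1 := fun ξ => (hCF ξ).2.2.1
  have hcyl : ∀ (ξ : Bdry I) (n : ℕ) (D : ℕ → Finset α), (∀ i < n, IsCliq I (D i)) →
      (leT I (cliqProd I D n) ξ.1 ↔ pref I (cliqProd I D n) (cliqProd I (C ξ) n)) := by
    refine fun ξ n D hD => ⟨fun h => ?_, fun h => leT_of_pref I h (hpre ξ n)⟩
    obtain ⟨N, hN⟩ := (hCF ξ).2.2.2 _ h
    exact cliqProd_pref_of_pref I hsymm hD (hE ξ) (hEadm ξ) hN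
  obtain ⟨m, hm⟩ : ∃ m, l.length = m + 1 :=
    Nat.exists_eq_succ_of_ne_zero (by simpa using hne)
  set D : ℕ → Finset α := fun i => l.getD i ∅ with hDdef
  have hDget : ∀ i (hi : i < l.length), D i = l[i] := fun i hi => by simp [hDdef, hi]
  have hD : ∀ i < m + 1, IsCliq I (D i) := fun i hi => by
    rw [← hm] at hi
    rw [hDget i hi]
    exact (hl _ (List.getElem_mem hi)).2
  have hDadm : ∀ i, i + 1 < m + 1 → CFadm I (D i) (D (i + 1)) := fun i hi => by
    rw [← hm] at hi
    rw [hDget i (by omega), hDget (i + 1) hi]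
    exact List.isChain_iff_getElem.1 hch i hi
  have hu : u = cliqProd I D (m + 1) := by rw [← hprod, prod_map_ctr_eq_cliqProd, hm]
  have hlast : l.getLast hne = D m := by
    rw [hDget m (by omega), List.getLast_eq_getElem]
    simp [hm]
  have hv : (l.dropLast.map (ctr I)).prod = cliqProd I D m := by
    rw [prod_map_ctr_eq_cliqProd, List.length_dropLast, hm, Nat.add_sub_cancel]
    refine cliqProd_congr I fun i hi => ?_
    rw [hDget i (by omega)]
    simp [hm, hi]
  rw [hv, hlast, hm, hu]
  constructor
  · ext ξ
    exact hcyl ξ _ D hD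
  · ext ξ
    simp only [Set.mem_sdiff, Set.mem_iUnion, Set.mem_ofPred_eq, cylSet, exists_prop, not_exists,
      not_and]
    constructor
    · intro h
      have hC : cliqProd I (C ξ) (m + 1) = cliqProd I D (m + 1) := cliqProd_congr I h
      refine ⟨hC ▸ hpre ξ (m + 1), fun c hc hξ => ?_⟩
      have hD' : ∀ i < m + 1, IsCliq I (Function.update D m c i) := by
        intro i hi
        rcases eq_or_ne i m with rfl | him
        · simpa using hc.1
        · simpa [him] using hD i hi
      have hprod' : cliqProd I (Function.update D m c) (m + 1) = cliqProd I D m * ctr I c := by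
        rw [cliqProd_succ, Function.update_self]
        congr 1
        exact cliqProd_congr I fun i hi => Function.update_of_ne hi.ne _ _
      rw [← hprod', hcyl ξ _ _ hD', hprod', hC, cliqProd_succ] at hξ
      have hlen := len_le_of_pref I hξ
      rw [len_mul, len_mul, len_ctr, len_ctr] at hlen
      have := Finset.card_lt_card hc.2
      omega
    · rintro ⟨h₁, h₂⟩
      rw [hcyl ξ _ D hD] at h₁
      by_cases heq : cliqProd I (C ξ) (m + 1) = cliqProd I D (m + 1)
      · exact cliqProd_injective I hsymm (fun i _ => hE ξ i) (fun i _ => hEadm ξ i) hD hDadm heq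
      · obtain ⟨c, hc, hDc, hp⟩ :=
          exists_insert_pref I hsymm hirr hD hDadm (fun i _ => hE ξ i) h₁ heq
        exact absurd (leT_of_pref I hp (hpre ξ (m + 1))) (h₂ c ⟨hc, hDc⟩)
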